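/- Let ℓ > 1 and assume each R i is an equivalence relation and R satisfies the weak commutativity frame property of degree ℓ. Let L = [i_1, …, i_m] be a duplicate-free list of agents with m ≥ ℓ, and let G be the set of its entries. Then the reflexive-transitive closure of the union relation R_G (where R_G w v iff ∃ i ∈ G, R i w v) coincides with comp(L): for all worlds w, w', ReflTransGen R_G w w' ↔ comp(L) w w'. (Semantic counterpart of the appendix theorem for wC_ℓ-S5_n: □_{i_1}…□_{i_m}φ ↔ C_G φ is a theorem.) -/

import Mathlib

/-- Relational composition along a list of agents. -/
def comp {W I : Type*} (R : I → W → W → Prop) : List I → W → W → Prop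
  | [], w, v => w = v
  | i :: l, w, v => ∃ u, R i w u ∧ comp R l u v

/-- The weak commutativity frame property of degree `ℓ`. -/
def WeakCommFrame {W I : Type*} (R : I → W → W → Prop) (ℓ : ℕ) : Prop :=
  ∀ L π : List I, L.Nodup → L.length = ℓ → π.Perm L →
    ∀ w v : W, comp R π w v → comp R L w v

theorem comp_append {W I : Type*} (R : I → W → W → Prop) (l₁ l₂ : List I) (w v : W) :
    comp R (l₁ ++ l₂) w v ↔ ∃ u, comp R l₁ w u ∧ comp R l₂ u v := by
  induction l₁ generalizing w with
  | nil => simp [comp]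
  | cons i l ih =>
    simp only [List.cons_append, comp, ih]
    constructor
    · rintro ⟨x, hx, u, hu, hv⟩
      exact ⟨u, ⟨x, hx, hu⟩, hv⟩
    · rintro ⟨u, ⟨x, hx, hu⟩, hv⟩
      exact ⟨x, hx, u, hu, hv⟩

theorem comp_refl {W I : Type*} {R : I → W → W → Prop} (hR : ∀ i w, R i w w) (l : List I)
    (w : W) : comp R l w w := by
  induction l with
  | nil => rfl
  | cons i l ih => exact ⟨w, hR i w, ih⟩

theorem reflTransGen_of_comp {W I : Type*} {R : I → W → W → Prop} {S : I → Prop} {l : List I}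
    (hl : ∀ i ∈ l, S i) {w v : W} (h : comp R l w v) :
    Relation.ReflTransGen (fun a b => ∃ i, S i ∧ R i a b) w v := by
  induction l generalizing w with
  | nil => cases h; exact .refl
  | cons i l ih =>
    obtain ⟨u, hu, huv⟩ := h
    exact .head ⟨i, hl i (by simp), hu⟩ (ih (fun j hj => hl j (by simp [hj])) huv)

/-- Weak commutativity of degree `ℓ > 1` passes to the next degree. -/
theorem WeakCommFrame.succ {W I : Type*} {R : I → W → W → Prop} {ℓ : ℕ}
    (hC : WeakCommFrame R ℓ) (hℓ : 1 < ℓ) : WeakCommFrame R (ℓ + 1) := by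
  classical
  intro L π hnd hlen hp w v h
  obtain _ | ⟨a, L'⟩ := L
  · simp at hlen
  obtain _ | ⟨b, π'⟩ := π
  · simp at hp
  have hlen' : L'.length = ℓ := by simpa using hlen
  obtain ⟨u, hbu, huv⟩ := h
  by_cases hab : a = b
  · subst hab
    exact ⟨u, hbu, hC L' π' hnd.of_cons hlen' hp.cons_inv u v huv⟩
  have hndπ : (b :: π').Nodup := hp.nodup_iff.mpr hnd
  have ha : a ∈ π' := by
    have : a ∈ b :: π' := hp.mem_iff.mpr (by simp)
    simpa [hab] using this
  obtain ⟨ρ, hρ⟩ : ∃ ρ, π'.Perm (a :: ρ) := ⟨_, List.perm_cons_erase ha⟩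
  have hba : (b :: a :: ρ).Perm (a :: L') := (hρ.symm.cons b).trans hp
  have hbρ : (b :: ρ).Perm L' := ((List.Perm.swap b a ρ).trans hba).cons_inv
  have hρlen : ρ.length + 1 = ℓ := by simpa [hlen'] using hbρ.length_eq
  have huv' : comp R (a :: ρ) u v :=
    hC (a :: ρ) π' (hρ.nodup_iff.mp hndπ.of_cons) (by simpa using hρlen) hρ u v huv
  have hndab : (a :: b :: ρ).Nodup := (hbρ.cons a).nodup_iff.mpr hnd
  have hswap : comp R (a :: b :: ρ) w v := by
    obtain rfl | ⟨σ, c, rfl⟩ := ρ.eq_nil_or_concat'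
    · simp at hρlen; omega
    obtain ⟨x, hx, hxv⟩ := (comp_append R (b :: a :: σ) [c] w v).mp ⟨u, hbu, huv'⟩
    refine (comp_append R (a :: b :: σ) [c] w v).mpr ⟨x, ?_, hxv⟩
    exact hC (a :: b :: σ) (b :: a :: σ) (List.Nodup.of_append_left (l₂ := [c]) hndab)
      (by simpa using hρlen) (List.Perm.swap a b σ) w x hx
  obtain ⟨y, hay, hyv⟩ := hswap
  exact ⟨y, hay, hC L' (b :: ρ) hnd.of_cons hlen' hbρ y v hyv⟩

theorem WeakCommFrame.mono {W I : Type*} {R : I → W → W → Prop} {ℓ m : ℕ}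
    (hC : WeakCommFrame R ℓ) (hℓ : 1 < ℓ) (hm : ℓ ≤ m) : WeakCommFrame R m := by
  induction m, hm using Nat.le_induction with
  | base => exact hC
  | succ n hn ih => exact ih.succ (hℓ.trans_le hn)

/-- Semantic counterpart of the appendix theorem for wC_ℓ-S5ₙ: the common-knowledge
relation of the agents of a duplicate-free list `L` (with `|L| ≥ ℓ`) coincides with
the composition along `L`. -/
theorem reflTransGen_iff_comp_weak {W I : Type*} (R : I → W → W → Prop)
    (hEq : ∀ i, Equivalence (R i))
    (ℓ : ℕ) (hℓ : 1 < ℓ) (hC : WeakCommFrame R ℓ)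
    (L : List I) (hnd : L.Nodup) (hm : ℓ ≤ L.length) :
    ∀ w w' : W,
      Relation.ReflTransGen (fun a b => ∃ i ∈ L, R i a b) w w' ↔ comp R L w w' := by
  classical
  intro w w'
  refine ⟨fun h => ?_, reflTransGen_of_comp fun _ hi => hi⟩
  have hL : WeakCommFrame R L.length := hC.mono hℓ hm
  induction h using Relation.ReflTransGen.head_induction_on with
  | refl => exact comp_refl (fun i => (hEq i).refl) L w'
  | head hstep _ ih =>
    obtain ⟨i, hi, hab⟩ := hstep
    have hp : L.Perm (i :: L.erase i) := List.perm_cons_erase hi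
    obtain ⟨u, hu, huv⟩ := hL _ L (hp.nodup_iff.mp hnd) hp.length_eq.symm hp _ _ ih
    exact hL L _ hnd rfl hp.symm _ _ ⟨u, (hEq i).trans hab hu, huv⟩
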